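/- Let n ≥ 0, l ≥ 1, and let f_0, …, f_{n+1} ∈ ℂ[x_0, …, x_{n+1}] be homogeneous polynomials of degree l whose only common zero in ℂ^{n+2} is the origin, and let Jac(f) := (∂f_i/∂x_j)_{0≤i,j≤n+1}. Then det(Jac(f)) ∉ ⟨f_0, …, f_{n+1}⟩, and for every homogeneous polynomial Q of degree (l−1)(n+2) there exists a unique c ∈ ℂ such that Q − c·det(Jac(f)) ∈ ⟨f_0, …, f_{n+1}⟩. -/

import Mathlib

open MvPolynomial

/-- The Jacobian matrix `(∂f_i/∂x_j)` of a tuple of polynomials. -/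
noncomputable def jacMatrix {N : ℕ} (f : Fin N → MvPolynomial (Fin N) ℂ) :
    Matrix (Fin N) (Fin N) (MvPolynomial (Fin N) ℂ) :=
  fun i j => MvPolynomial.pderiv j (f i)


theorem Matrix.det_mul_mem_of_mulVec_mem {ι R : Type*} [Fintype ι] [DecidableEq ι] [CommRing R]
    {I : Ideal R} {A : Matrix ι ι R} {v : ι → R} (h : ∀ i, A.mulVec v i ∈ I) (j : ι) :
    A.det * v j ∈ I := by
  have key : A.det * v j = (A.adjugate.mulVec (A.mulVec v)) j := by
    rw [Matrix.mulVec_mulVec, Matrix.adjugate_mul, Matrix.smul_mulVec, Matrix.one_mulVec]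
    simp
  rw [key]
  exact Ideal.sum_mem _ fun i _ => I.mul_mem_left _ (h i)

namespace MvPolynomial

variable {σ R : Type*} [CommRing R]

theorem mem_span_X_pow_image {s : Set σ} {N : ℕ} {p : MvPolynomial σ R} :
    p ∈ Ideal.span ((fun i => (X i : MvPolynomial σ R) ^ N) '' s) ↔
      ∀ m ∈ p.support, ∃ i ∈ s, N ≤ m i := by
  have := @mem_ideal_span_monomial_image σ R _ p ((fun i => Finsupp.single i N) '' s)
  rw [Set.image_image] at this
  simpa [X_pow_eq_monomial] using this

theorem mem_span_X_pow_image_of_mul_X_mem {s : Set σ} {N : ℕ} {i : σ} (hi : i ∉ s)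
    {p : MvPolynomial σ R}
    (h : p * X i ∈ Ideal.span ((fun i => (X i : MvPolynomial σ R) ^ N) '' s)) :
    p ∈ Ideal.span ((fun i => (X i : MvPolynomial σ R) ^ N) '' s) := by
  classical
  rw [mem_span_X_pow_image] at h ⊢
  intro m hm
  obtain ⟨k, hk, hle⟩ := h (m + Finsupp.single i 1) (by simpa [support_mul_X] using hm)
  refine ⟨k, hk, ?_⟩
  have hik : i ≠ k := fun e => hi (e ▸ hk)
  simpa [Finsupp.single_apply, hik] using hle

theorem algHom_sub_algHom_mem_span {B : Type*} [CommRing B] [Algebra R B]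
    (φ ψ : MvPolynomial σ R →ₐ[R] B) (p : MvPolynomial σ R) :
    φ p - ψ p ∈ Ideal.span (Set.range fun i => φ (X i) - ψ (X i)) := by
  set I := Ideal.span (Set.range fun i => φ (X i) - ψ (X i))
  have : (Ideal.Quotient.mkₐ R I).comp φ = (Ideal.Quotient.mkₐ R I).comp ψ :=
    algHom_ext fun i => Ideal.Quotient.eq.mpr (Ideal.subset_span ⟨i, rfl⟩)
  exact Ideal.Quotient.eq.mp (DFunLike.congr_fun this p)

theorem sub_C_constantCoeff_mem_of_X_mem {I : Ideal (MvPolynomial σ R)} (hI : ∀ i, X i ∈ I)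
    (p : MvPolynomial σ R) : p - C (constantCoeff p) ∈ I := by
  have h := algHom_sub_algHom_mem_span (AlgHom.id R (MvPolynomial σ R)) (aeval fun _ => 0) p
  simp only [AlgHom.id_apply, aeval_X, sub_zero, aeval_zero'] at h
  exact Ideal.span_le.mpr (Set.range_subset_iff.mpr hI) h

theorem mem_of_mul_mem_of_constantCoeff_ne_zero {k : Type*} [Field k]
    {I : Ideal (MvPolynomial σ k)} (hI : ∀ i, X i ∈ I.radical) {p w : MvPolynomial σ k}
    (hw : constantCoeff w ≠ 0) (h : p * w ∈ I) : p ∈ I := by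
  have hnil : IsNilpotent (Ideal.Quotient.mk I (w - C (constantCoeff w))) := by
    obtain ⟨N, hN⟩ := sub_C_constantCoeff_mem_of_X_mem hI w
    exact ⟨N, by rw [← map_pow, Ideal.Quotient.eq_zero_iff_mem.mpr hN]⟩
  have hu : IsUnit (Ideal.Quotient.mk I (C (constantCoeff w))) :=
    ((IsUnit.mk0 _ hw).map C).map (Ideal.Quotient.mk I)
  have := hnil.isUnit_add_left_of_commute hu (Commute.all _ _)
  rw [← map_add, add_sub_cancel] at this
  rw [← Ideal.Quotient.eq_zero_iff_mem, map_mul, this.mul_left_eq_zero] at h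
  exact Ideal.Quotient.eq_zero_iff_mem.mp h

attribute [local instance] MvPolynomial.gradedAlgebra in
/-- A functional detecting a homogeneous `J ∉ I` of degree `D`, supported in degree `D`. -/
theorem exists_dual_of_notMem {k : Type*} [Field k] {I : Ideal (MvPolynomial σ k)}
    (hI : I.IsHomogeneous (homogeneousSubmodule σ k)) {J : MvPolynomial σ k} {D : ℕ}
    (hJ : J.IsHomogeneous D) (hJI : J ∉ I) :
    ∃ τ : MvPolynomial σ k →ₗ[k] k, (∀ p ∈ I, τ p = 0) ∧ τ J ≠ 0 ∧
      ∀ g : MvPolynomial σ k, g.IsHomogeneous D → ∀ u, τ (g * u) = constantCoeff u * τ g := by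
  obtain ⟨τ, hτJ, hτ⟩ := Submodule.exists_le_ker_of_notMem
    (p := I.restrictScalars k) (v := J) (by simpa using hJI)
  refine ⟨τ ∘ₗ homogeneousComponent D, fun p hp => ?_, ?_, fun g hg u => ?_⟩
  · exact hτ (homogeneousComponent_mem_of_mem hI hp D)
  · simpa [homogeneousComponent_eq_self hJ] using hτJ
  · suffices h : homogeneousComponent D (g * u) = constantCoeff u • g by
      rw [LinearMap.comp_apply, LinearMap.comp_apply, homogeneousComponent_eq_self hg, h, map_smul,
        smul_eq_mul]
    induction u using MvPolynomial.induction_on' with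
    | monomial d a =>
      classical
      rcases eq_or_ne d 0 with rfl | hd
      · rw [← C_apply, mul_comm, homogeneousComponent_C_mul, homogeneousComponent_eq_self hg,
          constantCoeff_C, smul_eq_C_mul]
      · have hd' : d.degree ≠ 0 := (Finsupp.degree_eq_zero_iff d).not.mpr hd
        rw [homogeneousComponent_of_mem (hg.mul (isHomogeneous_monomial a rfl)),
          if_neg (by omega), constantCoeff_monomial, if_neg hd, zero_smul]
    | add p q hp hq => rw [mul_add, map_add, hp, hq, map_add, add_smul]

attribute [local instance] MvPolynomial.gradedAlgebra in
theorem isHomogeneous_span_range {f : σ → MvPolynomial σ R} {l : ℕ}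
    (hhom : ∀ i, (f i).IsHomogeneous l) :
    (Ideal.span (Set.range f)).IsHomogeneous (homogeneousSubmodule σ R) := by
  refine Ideal.homogeneous_span _ _ ?_
  rintro _ ⟨i, rfl⟩
  exact ⟨l, hhom i⟩

variable [Fintype σ] [DecidableEq σ]

/-- A matrix expressing the powers `X i ^ (N + 1)` in terms of the variables has the same determinant
modulo these powers as the diagonal matrix with entries `X i ^ N`. -/
theorem det_sub_prod_X_pow_mem {N : ℕ} {A : Matrix σ σ (MvPolynomial σ R)}
    (hA : A.mulVec X = fun i => X i ^ (N + 1)) :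
    A.det - ∏ i, X i ^ N ∈
      Ideal.span (Set.range fun i => (X i : MvPolynomial σ R) ^ (N + 1)) := by
  set K := Ideal.span (Set.range fun i => (X i : MvPolynomial σ R) ^ (N + 1))
  suffices H : ∀ s : Finset σ, ∀ A : Matrix σ σ (MvPolynomial σ R),
      (A.mulVec X = fun i => X i ^ (N + 1)) → (∀ i ∉ s, A i = Pi.single i (X i ^ N)) →
      A.det - ∏ i, X i ^ N ∈ K from H Finset.univ A hA (by simp)
  intro s
  induction s using Finset.induction_on with
  | empty =>
    intro A _ h
    have : A = Matrix.diagonal fun i => X i ^ N := by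
      ext1 i j
      rw [h i (Finset.notMem_empty i), Matrix.diagonal_apply, Pi.single_apply]
      simp only [eq_comm]
    simp [this]
  | insert i s _ ih =>
    intro A hA h
    set d : σ → MvPolynomial σ R := Pi.single i (X i ^ N) with hd
    have hdX : d ⬝ᵥ X = X i ^ (N + 1) := by simp [hd, pow_succ]
    have hupd (u : σ → MvPolynomial σ R) (k : σ) :
        ((A.updateRow i u).mulVec X) k = if k = i then u ⬝ᵥ X else X k ^ (N + 1) := by
      by_cases hk : k = i
      · subst hk; simp [Matrix.mulVec]
      · simpa [Matrix.mulVec, hk] using congrFun hA k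
    have h₁ : (A.updateRow i d).det - ∏ i, X i ^ N ∈ K := by
      refine ih _ ?_ fun k hk => ?_
      · funext k
        rw [hupd, hdX]
        split_ifs with hk
        · rw [hk]
        · rfl
      · by_cases hki : k = i
        · subst hki; simp [hd]
        · simpa [hki] using h k (by simp [hki, hk])
    have h₂ : A.det - (A.updateRow i d).det = (A.updateRow i (A i - d)).det := by
      have := Matrix.det_updateRow_add A i (A i - d) d
      rw [sub_add_cancel, Matrix.updateRow_eq_self] at this
      rw [this, add_sub_cancel_right]
    have h₃ : (A.updateRow i (A i - d)).det ∈ K := by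
      have hle : Ideal.span ((fun i => (X i : MvPolynomial σ R) ^ (N + 1)) '' {i}ᶜ) ≤ K :=
        Ideal.span_mono (Set.image_subset_range _ _)
      refine hle (mem_span_X_pow_image_of_mul_X_mem (i := i) (by simp) ?_)
      refine Matrix.det_mul_mem_of_mulVec_mem (fun k => ?_) i
      rw [hupd]
      split_ifs with hk
      · have : A i ⬝ᵥ X = X i ^ (N + 1) := congrFun hA i
        rw [sub_dotProduct, this, hdX, sub_self]
        exact zero_mem _
      · exact Ideal.subset_span ⟨k, hk, rfl⟩
    have : A.det - ∏ i, X i ^ N =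
        (A.updateRow i (A i - d)).det + ((A.updateRow i d).det - ∏ i, X i ^ N) := by
      rw [← h₂]; ring
    rw [this]
    exact add_mem h₃ h₁

theorem prod_X_pow_notMem [Nontrivial R] (N : ℕ) :
    ∏ i, X i ^ N ∉ Ideal.span (Set.range fun i => (X i : MvPolynomial σ R) ^ (N + 1)) := by
  have hprod : ∏ i, (X i : MvPolynomial σ R) ^ N =
      monomial (Finsupp.equivFunOnFinite.symm fun _ => N) 1 := by
    rw [monomial_eq]
    simp [Finsupp.prod_fintype]
  rw [← Set.image_univ, mem_span_X_pow_image, hprod]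
  simp

/-- If the variables are nilpotent modulo `⟨f i⟩` and `f = A X`, then `det A ∉ ⟨f i⟩`. -/
theorem det_notMem_span_of_mulVec_X_eq [Nontrivial R] {f : σ → MvPolynomial σ R}
    (hf : ∀ i, X i ∈ (Ideal.span (Set.range f)).radical) {A : Matrix σ σ (MvPolynomial σ R)}
    (hA : A.mulVec X = f) : A.det ∉ Ideal.span (Set.range f) := by
  intro hdet
  choose e he using hf
  set N := Finset.univ.sup e
  have hpow (i : σ) : X i ^ (N + 1) ∈ Ideal.span (Set.range f) :=
    Ideal.pow_mem_of_pow_mem _ (he i) ((Finset.le_sup (Finset.mem_univ i)).trans N.le_succ)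
  simp only [Ideal.mem_span_range_iff_exists_fun] at hpow
  choose B hB using hpow
  have hBf : (Matrix.of B).mulVec f = fun i => X i ^ (N + 1) :=
    _root_.funext hB
  have hBA := det_sub_prod_X_pow_mem (A := Matrix.of B * A) (N := N)
    (by rw [← Matrix.mulVec_mulVec, hA, hBf])
  refine prod_X_pow_notMem (R := R) (σ := σ) N ((Submodule.sub_mem_iff_right _ ?_).mp hBA)
  obtain ⟨c, hc⟩ := Ideal.mem_span_range_iff_exists_fun.mp hdet
  rw [Matrix.det_mul, ← hc, Finset.mul_sum]
  refine Ideal.sum_mem _ fun j _ => ?_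
  rw [mul_left_comm]
  refine Ideal.mul_mem_left _ _ (Matrix.det_mul_mem_of_mulVec_mem (fun i => ?_) j)
  rw [hBf]
  exact Ideal.subset_span ⟨i, rfl⟩

open TensorProduct in
/-- A functional `τ` on `k[X]` vanishing on `I = ⟨f i⟩` yields, by contracting a Bezoutian
determinant of `f`, an element `w` such that `g * w = τ g • e` modulo `I`, with `e ∉ I`, for
all `g` which `τ` treats as socle elements. -/
theorem exists_mul_sub_mem_of_dual {k : Type*} [Field k] {f : σ → MvPolynomial σ k}
    (hf : ∀ i, X i ∈ (Ideal.span (Set.range f)).radical) (hf0 : ∀ i, constantCoeff (f i) = 0)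
    (τ : MvPolynomial σ k →ₗ[k] k) (hτ : ∀ p ∈ Ideal.span (Set.range f), τ p = 0) :
    ∃ w e : MvPolynomial σ k, e ∉ Ideal.span (Set.range f) ∧
      ∀ g, (∀ u, τ (g * u) = constantCoeff u * τ g) →
        g * w - C (τ g) * e ∈ Ideal.span (Set.range f) := by
  set I := Ideal.span (Set.range f)
  let φ : MvPolynomial σ k →ₐ[k] MvPolynomial σ k ⊗[k] MvPolynomial σ k :=
    Algebra.TensorProduct.includeLeft
  let ψ : MvPolynomial σ k →ₐ[k] MvPolynomial σ k ⊗[k] MvPolynomial σ k :=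
    Algebra.TensorProduct.includeRight
  let ε : MvPolynomial σ k ⊗[k] MvPolynomial σ k →ₐ[k] MvPolynomial σ k :=
    Algebra.TensorProduct.lift (aeval fun _ => 0) (AlgHom.id k _) fun _ _ => Commute.all _ _
  let T : MvPolynomial σ k ⊗[k] MvPolynomial σ k →ₗ[k] MvPolynomial σ k ⧸ I :=
    (TensorProduct.lid k _).toLinearMap ∘ₗ TensorProduct.map τ (Ideal.Quotient.mkₐ k I).toLinearMap
  have hT (u v : MvPolynomial σ k) : T (u ⊗ₜ v) = τ u • Ideal.Quotient.mk I v := by simp [T]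
  have hε (u v : MvPolynomial σ k) : ε (u ⊗ₜ v) = C (constantCoeff u) * v := by
    simp only [ε, Algebra.TensorProduct.lift_tmul, AlgHom.id_apply, aeval_zero',
      algebraMap_eq]
  have hTψ (g : MvPolynomial σ k) (z : MvPolynomial σ k ⊗[k] MvPolynomial σ k) :
      T (ψ g * z) = Ideal.Quotient.mk I g * T z := by
    induction z using TensorProduct.induction_on with
    | zero => simp
    | tmul u v =>
      rw [Algebra.TensorProduct.includeRight_apply, Algebra.TensorProduct.tmul_mul_tmul, hT, hT,
        one_mul, map_mul, mul_smul_comm]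
    | add a b ha hb => rw [mul_add, map_add, map_add, ha, hb, mul_add]
  have hTφ (i : σ) (z : MvPolynomial σ k ⊗[k] MvPolynomial σ k) : T (φ (f i) * z) = 0 := by
    induction z using TensorProduct.induction_on with
    | zero => simp
    | tmul u v =>
      rw [Algebra.TensorProduct.includeLeft_apply, Algebra.TensorProduct.tmul_mul_tmul, hT,
        hτ _ (I.mul_mem_right _ (Ideal.subset_span ⟨i, rfl⟩)), zero_smul]
    | add a b ha hb => rw [mul_add, map_add, ha, hb, add_zero]
  have hTK (z : MvPolynomial σ k ⊗[k] MvPolynomial σ k)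
      (hz : z ∈ Ideal.span (Set.range fun i => φ (f i) - ψ (f i))) :
      T z = 0 := by
    obtain ⟨c, rfl⟩ := Ideal.mem_span_range_iff_exists_fun.mp hz
    rw [map_sum]
    refine Finset.sum_eq_zero fun i _ => ?_
    rw [mul_comm, sub_mul, map_sub, hTφ, hTψ,
      Ideal.Quotient.eq_zero_iff_mem.mpr (Ideal.subset_span (Set.mem_range_self i)), zero_mul,
      sub_zero]
  choose a ha using fun i => Ideal.mem_span_range_iff_exists_fun.mp
    (algHom_sub_algHom_mem_span φ ψ (f i))
  let A : Matrix σ σ (MvPolynomial σ k ⊗[k] MvPolynomial σ k) := Matrix.of a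
  have hA (g : MvPolynomial σ k) :
      (φ g - ψ g) * A.det ∈ Ideal.span (Set.range fun i => φ (f i) - ψ (f i)) := by
    obtain ⟨c, hc⟩ := Ideal.mem_span_range_iff_exists_fun.mp (algHom_sub_algHom_mem_span φ ψ g)
    rw [← hc, Finset.sum_mul]
    refine Ideal.sum_mem _ fun j _ => ?_
    rw [mul_assoc, mul_comm _ A.det]
    refine Ideal.mul_mem_left _ _ (Matrix.det_mul_mem_of_mulVec_mem
      (v := fun j => φ (X j) - ψ (X j)) (fun i => Ideal.subset_span ?_) j)
    exact ⟨i, (ha i).symm⟩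
  have hεφ (p : MvPolynomial σ k) : ε (φ p) = C (constantCoeff p) := by
    rw [Algebra.TensorProduct.includeLeft_apply, hε, mul_one]
  have hεψ (p : MvPolynomial σ k) : ε (ψ p) = p := by
    rw [Algebra.TensorProduct.includeRight_apply, hε, map_one, map_one, one_mul]
  have hεA : (A.map ε).mulVec X = f := by
    funext i
    have := congrArg ε (ha i)
    simp only [map_sum, map_mul, map_sub, hεφ, hεψ, hf0, constantCoeff_X, map_zero, zero_sub,
      mul_neg, Finset.sum_neg_distrib, neg_inj] at this
    exact this
  obtain ⟨w, hw⟩ := Ideal.Quotient.mk_surjective (T A.det)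
  refine ⟨w, (A.map ε).det, det_notMem_span_of_mulVec_X_eq hf hεA, fun g hg => ?_⟩
  have hTg (z : MvPolynomial σ k ⊗[k] MvPolynomial σ k) :
      T (φ g * z) = Ideal.Quotient.mk I (C (τ g) * ε z) := by
    induction z using TensorProduct.induction_on with
    | zero => simp
    | tmul u v =>
      rw [Algebra.TensorProduct.includeLeft_apply, Algebra.TensorProduct.tmul_mul_tmul, hT, hg, hε,
        one_mul, ← mul_assoc, ← C_mul, mul_comm (τ g), ← smul_eq_C_mul]
      rfl
    | add a b ha hb => rw [mul_add, map_add, ha, hb, map_add, mul_add, map_add]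
  have key := hTK _ (hA g)
  have hdet : (A.map ε).det = ε A.det := (AlgHom.map_det ε A).symm
  rw [sub_mul, map_sub, hTg, hTψ, ← hw, ← map_mul, ← map_sub, Ideal.Quotient.eq_zero_iff_mem] at key
  rw [hdet, ← neg_sub]
  exact neg_mem key

/-- The socle of `k[X] / ⟨f i⟩` in degree `D` is spanned by any nonzero socle element of that
degree. -/
theorem exists_sub_C_mul_mem_span {σ k : Type*} [Fintype σ] [DecidableEq σ] [Field k]
    {f : σ → MvPolynomial σ k} (hf : ∀ i, X i ∈ (Ideal.span (Set.range f)).radical)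
    (hf0 : ∀ i, constantCoeff (f i) = 0)
    {l : ℕ} (hhom : ∀ i, (f i).IsHomogeneous l) {J : MvPolynomial σ k} {D : ℕ}
    (hJ : J.IsHomogeneous D) (hJI : J ∉ Ideal.span (Set.range f))
    (hJX : ∀ i, J * X i ∈ Ideal.span (Set.range f)) {Q : MvPolynomial σ k}
    (hQ : Q.IsHomogeneous D) : ∃ c : k, Q - C c * J ∈ Ideal.span (Set.range f) := by
  set I := Ideal.span (Set.range f)
  obtain ⟨τ, hτI, hτJ, hτ⟩ := exists_dual_of_notMem (isHomogeneous_span_range hhom) hJ hJI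
  obtain ⟨w, e, he, hw⟩ := exists_mul_sub_mem_of_dual hf hf0 τ hτI
  have hw0 : constantCoeff w ≠ 0 := by
    intro hw0
    have hJw : J * w ∈ I := by
      have hX : ∀ i, X i ∈ Submodule.colon I {J} := fun i =>
        Submodule.mem_colon_singleton.mpr (by simpa [mul_comm] using hJX i)
      have := Submodule.mem_colon_singleton.mp (sub_C_constantCoeff_mem_of_X_mem hX w)
      simpa [hw0, mul_comm] using this
    have h := (Submodule.sub_mem_iff_right _ hJw).mp (hw J (hτ J hJ))
    refine he ?_
    have := I.mul_mem_left (C (τ J)⁻¹) h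
    rwa [← mul_assoc, ← C_mul, inv_mul_cancel₀ hτJ, C_1, one_mul] at this
  refine ⟨τ Q / τ J, mem_of_mul_mem_of_constantCoeff_ne_zero hf hw0 ?_⟩
  have hg : (Q - C (τ Q / τ J) * J).IsHomogeneous D :=
    hQ.sub (by simpa using (isHomogeneous_C σ (τ Q / τ J)).mul hJ)
  have h := hw _ (hτ _ hg)
  have h0 : τ (Q - C (τ Q / τ J) * J) = 0 := by
    rw [map_sub, ← smul_eq_C_mul, map_smul, smul_eq_mul, div_mul_cancel₀ _ hτJ, sub_self]
  rwa [h0, C_0, zero_mul, sub_zero] at h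

/-- If the origin is the only possible common zero of the `f i`, then the variables lie in the
radical of `⟨f i⟩`. -/
theorem X_mem_radical_of_zeroLocus {σ k : Type*} [Finite σ] [Field k] [IsAlgClosed k]
    {f : σ → MvPolynomial σ k} (hzero : ∀ x : σ → k, (∀ i, eval x (f i) = 0) → x = 0) (i : σ) :
    X i ∈ (Ideal.span (Set.range f)).radical := by
  rw [← vanishingIdeal_zeroLocus_eq_radical (K := k), mem_vanishingIdeal_iff]
  intro x hx
  have : x = 0 := hzero x fun j => by
    simpa [aeval_eq_eval] using hx (f j) (Ideal.subset_span ⟨j, rfl⟩)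
  simp [this]

end MvPolynomial

theorem jacMatrix_mulVec_X {N l : ℕ} {f : Fin N → MvPolynomial (Fin N) ℂ}
    (hhom : ∀ i, (f i).IsHomogeneous l) (i : Fin N) : (jacMatrix f).mulVec X i = l • f i := by
  rw [← (hhom i).sum_X_mul_pderiv]
  simp only [Matrix.mulVec, dotProduct, jacMatrix, mul_comm]

theorem isHomogeneous_det_jacMatrix {N l : ℕ} {f : Fin N → MvPolynomial (Fin N) ℂ}
    (hhom : ∀ i, (f i).IsHomogeneous l) : (jacMatrix f).det.IsHomogeneous ((l - 1) * N) := by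
  rw [Matrix.det_apply]
  refine IsHomogeneous.sum _ _ _ fun g _ => ?_
  have h := IsHomogeneous.prod Finset.univ (fun i => jacMatrix f (g i) i) (fun _ => l - 1)
    fun i _ => (hhom (g i)).pderiv
  rw [Finset.sum_const, Finset.card_univ, Fintype.card_fin, smul_eq_mul, mul_comm] at h
  rcases Int.units_eq_one_or (Equiv.Perm.sign g) with hs | hs
  · simpa [hs] using h
  · simpa [hs] using h.neg

theorem det_jacMatrix_notMem_span {N l : ℕ} (hl : 1 ≤ l) {f : Fin N → MvPolynomial (Fin N) ℂ}
    (hhom : ∀ i, (f i).IsHomogeneous l)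
    (hf : ∀ i, X i ∈ (Ideal.span (Set.range f)).radical) :
    (jacMatrix f).det ∉ Ideal.span (Set.range f) := by
  intro h
  have hl0 : (l : ℂ) ≠ 0 := by exact_mod_cast (by omega : l ≠ 0)
  refine det_notMem_span_of_mulVec_X_eq hf
    (A := (C (l : ℂ)⁻¹ : MvPolynomial (Fin N) ℂ) • jacMatrix f) ?_ ?_
  · funext i
    rw [Matrix.smul_mulVec, Pi.smul_apply, jacMatrix_mulVec_X hhom, smul_eq_mul, nsmul_eq_mul,
      ← mul_assoc, ← map_natCast (C : ℂ →+* MvPolynomial (Fin N) ℂ), ← C_mul, inv_mul_cancel₀ hl0,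
      C_1, one_mul]
  · rw [Matrix.det_smul]
    exact Ideal.mul_mem_left _ _ h

theorem det_jac_spans_top_piece (n l : ℕ) (hl : 1 ≤ l)
    (f : Fin (n + 2) → MvPolynomial (Fin (n + 2)) ℂ)
    (hhom : ∀ i, (f i).IsHomogeneous l)
    (hzero : ∀ x : Fin (n + 2) → ℂ, (∀ i, MvPolynomial.eval x (f i) = 0) → x = 0) :
    (jacMatrix f).det ∉ Ideal.span (Set.range f) ∧
      ∀ Q : MvPolynomial (Fin (n + 2)) ℂ, Q.IsHomogeneous ((l - 1) * (n + 2)) →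
        ∃! c : ℂ, Q - C c * (jacMatrix f).det ∈ Ideal.span (Set.range f) := by
  set I := Ideal.span (Set.range f)
  have hf := X_mem_radical_of_zeroLocus hzero
  have hJI := det_jacMatrix_notMem_span hl hhom hf
  refine ⟨hJI, fun Q hQ => ?_⟩
  have hf0 (i) : constantCoeff (f i) = 0 :=
    (hhom i).coeff_eq_zero (d := 0) (by rw [map_zero]; omega)
  have hJX (i) : (jacMatrix f).det * X i ∈ I := by
    refine Matrix.det_mul_mem_of_mulVec_mem (fun j => ?_) i
    rw [jacMatrix_mulVec_X hhom]
    exact nsmul_mem (Ideal.subset_span (Set.mem_range_self j)) l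
  obtain ⟨c, hc⟩ := exists_sub_C_mul_mem_span hf hf0 hhom (isHomogeneous_det_jacMatrix hhom) hJI
    hJX hQ
  refine ⟨c, hc, fun d hd => ?_⟩
  by_contra hne
  have h := I.mul_mem_left (C (c - d)⁻¹) (sub_mem hd hc)
  rw [sub_sub_sub_cancel_left, ← sub_mul, ← C_sub, ← mul_assoc, ← C_mul,
    inv_mul_cancel₀ (sub_ne_zero.mpr (Ne.symm hne)), C_1, one_mul] at h
  exact hJI h
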